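/- Let G=(V,E) be a 2-vertex-twinless connected directed graph with n = |V| vertices. Let E_{2v} ⊆ E be such that (V,E_{2v}) is 2-vertex-connected, and let a_t be the number of twinless articulation points of (V,E_{2v}). Then there exists E_{2t} with E_{2v} ⊆ E_{2t} ⊆ E such that (V,E_{2t}) is 2-vertex-twinless connected and |E_{2t}| ≤ |E_{2v}| + a_t·(n−1). -/

import Mathlib

/-- `F` contains no pair of antiparallel edges. -/
def NoAntiparallel {V : Type*} (F : Finset (V × V)) : Prop :=
  ∀ a b : V, (a, b) ∈ F → (b, a) ∉ F

/-- There is a directed path from `u` to `v` using edges of `F` that stay inside `S`. -/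
def PathOn {V : Type*} (F : Finset (V × V)) (S : Set V) (u v : V) : Prop :=
  Relation.ReflTransGen (fun a b => a ∈ S ∧ b ∈ S ∧ (a, b) ∈ F) u v

/-- The subgraph of `(V, E)` induced on `S` is strongly connected. -/
def StronglyConnectedOn {V : Type*} (E : Finset (V × V)) (S : Set V) : Prop :=
  ∀ u ∈ S, ∀ v ∈ S, PathOn E S u v

/-- The subgraph of `(V, E)` induced on `S` is twinless strongly connected. -/
def TwinlessSConnOn {V : Type*} (E : Finset (V × V)) (S : Set V) : Prop :=
  ∃ E' ⊆ E, NoAntiparallel E' ∧ StronglyConnectedOn E' S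

/-- `(V, E)` is 2-vertex-connected. -/
def TwoVertexConnected (V : Type*) [Fintype V] (E : Finset (V × V)) : Prop :=
  3 ≤ Fintype.card V ∧ ∀ U : Finset V, U.card ≤ 1 → StronglyConnectedOn E (↑U)ᶜ

/-- `(V, E)` is 2-vertex-twinless connected. -/
def TwoVertexTwinlessConnected (V : Type*) [Fintype V] (E : Finset (V × V)) : Prop :=
  3 ≤ Fintype.card V ∧ ∀ U : Finset V, U.card ≤ 1 → TwinlessSConnOn E (↑U)ᶜ

/-- `u` and `v` are twinless strongly connected in the subgraph of `(V, E)` induced on `S`. -/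
def TwinlessRelOn {V : Type*} (E : Finset (V × V)) (S : Set V) (u v : V) : Prop :=
  ∃ F ⊆ E, NoAntiparallel F ∧ PathOn F S u v ∧ PathOn F S v u

/-- `u` and `v` are twinless strongly connected in `(V, E)`. -/
def TwinlessRel {V : Type*} (E : Finset (V × V)) (u v : V) : Prop :=
  TwinlessRelOn E Set.univ u v

/-- `C` is a twinless strongly connected component of `(V, E)`. -/
def IsTSCC {V : Type*} (E : Finset (V × V)) (C : Set V) : Prop :=
  ∃ v : V, C = {u | TwinlessRel E v u}

/-- The number of twinless strongly connected components of `(V, E)`. -/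
noncomputable def numTSCC (V : Type*) (E : Finset (V × V)) : ℕ :=
  Set.ncard {C : Set V | IsTSCC E C}

/-- `Q` is the edge set and `A` the vertex set of a simple directed path from the first
argument to the last. -/
inductive IsSimplePath {V : Type*} : V → Set (V × V) → Set V → V → Prop
  | single (v : V) : IsSimplePath v ∅ {v} v
  | cons {a b w : V} {Q : Set (V × V)} {A : Set V} (ha : a ∉ A) (h : IsSimplePath b Q A w) :
      IsSimplePath a (insert (a, b) Q) (insert a A) w

namespace IsSimplePath

variable {V : Type*} {v w : V} {Q : Set (V × V)} {A : Set V}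

lemma start_mem (h : IsSimplePath v Q A w) : v ∈ A := by
  cases h <;> simp

lemma edges_subset (h : IsSimplePath v Q A w) : ∀ a b, (a, b) ∈ Q → a ∈ A ∧ b ∈ A := by
  induction h with
  | single v => simp
  | cons ha h ih =>
    rintro p q (hpq | hpq)
    · obtain ⟨rfl, rfl⟩ := Prod.mk.inj hpq
      exact ⟨Or.inl rfl, Or.inr h.start_mem⟩
    · exact ⟨Or.inr (ih _ _ hpq).1, Or.inr (ih _ _ hpq).2⟩

lemma no_antiparallel (h : IsSimplePath v Q A w) : ∀ a b, (a, b) ∈ Q → (b, a) ∉ Q := by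
  induction h with
  | single v => simp
  | cons ha h ih =>
    rintro p q (hpq | hpq) (hqp | hqp)
    · obtain ⟨rfl, rfl⟩ := Prod.mk.inj hpq
      obtain ⟨rfl, -⟩ := Prod.mk.inj hqp
      exact ha h.start_mem
    · obtain ⟨rfl, rfl⟩ := Prod.mk.inj hpq
      exact ha (h.edges_subset _ _ hqp).2
    · obtain ⟨rfl, rfl⟩ := Prod.mk.inj hqp
      exact ha (h.edges_subset _ _ hpq).2
    · exact ih _ _ hpq hqp

lemma reach (h : IsSimplePath v Q A w) : ∀ x ∈ A,
    Relation.ReflTransGen (fun a b => (a, b) ∈ Q) v x ∧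
      Relation.ReflTransGen (fun a b => (a, b) ∈ Q) x w := by
  induction h with
  | single v =>
    rintro x rfl
    exact ⟨.refl, .refl⟩
  | cons ha h ih =>
    rename_i a b w Q A
    have mono : ∀ {x y}, Relation.ReflTransGen (fun a b => (a, b) ∈ Q) x y →
        Relation.ReflTransGen (fun p q => (p, q) ∈ insert (a, b) Q) x y :=
      fun hxy => Relation.ReflTransGen.mono (fun _ _ hpq => Or.inr hpq) _ _ hxy
    rintro x (rfl | hx)
    · exact ⟨.refl, .head (Or.inl rfl) (mono (ih _ h.start_mem).2)⟩
    · exact ⟨.head (Or.inl rfl) (mono (ih _ hx).1), mono (ih _ hx).2⟩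

lemma exists_suffix (h : IsSimplePath v Q A w) : ∀ x ∈ A,
    ∃ Q' ⊆ Q, ∃ A' ⊆ A, IsSimplePath x Q' A' w := by
  induction h with
  | single v =>
    rintro x rfl
    exact ⟨_, subset_rfl, _, subset_rfl, .single _⟩
  | cons ha h ih =>
    rintro x (rfl | hx)
    · exact ⟨_, subset_rfl, _, subset_rfl, .cons ha h⟩
    · obtain ⟨Q', hQ, A', hA, h'⟩ := ih x hx
      exact ⟨Q', hQ.trans (Set.subset_insert _ _), A', hA.trans (Set.subset_insert _ _), h'⟩

end IsSimplePath

namespace PathOn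

variable {V : Type*} {K K' : Finset (V × V)} {S S' T C X : Set V} {u v w : V}

lemma mono (hK : K ⊆ K') (hS : S ⊆ S') (h : PathOn K S u v) : PathOn K' S' u v :=
  Relation.ReflTransGen.mono (fun _ _ hab => ⟨hS hab.1, hS hab.2.1, hK hab.2.2⟩) _ _ h

lemma exists_isSimplePath (h : PathOn K T v w) (hw : w ∈ T) :
    ∃ (Q : Set (V × V)) (A : Set V), Q ⊆ K ∧ A ⊆ T ∧ IsSimplePath v Q A w := by
  induction h using Relation.ReflTransGen.head_induction_on with
  | refl => exact ⟨∅, {w}, by simp, by simpa using hw, .single w⟩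
  | head hab hrest ih =>
    rename_i a b
    obtain ⟨Q, A, hQ, hA, h⟩ := ih
    by_cases ha : a ∈ A
    · obtain ⟨Q', hQ', A', hA', h'⟩ := h.exists_suffix a ha
      exact ⟨Q', A', hQ'.trans hQ, hA'.trans hA, h'⟩
    · exact ⟨_, _, Set.insert_subset hab.2.2 hQ, Set.insert_subset hab.1 hA, .cons ha h⟩

lemma exists_crossing (h : PathOn K S u v) (hu : u ∈ X) (hv : v ∉ X) :
    ∃ a b, a ∈ X ∧ b ∉ X ∧ a ∈ S ∧ b ∈ S ∧ (a, b) ∈ K := by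
  induction h with
  | refl => exact absurd hu hv
  | tail hrest hbc ih =>
    rename_i b c
    by_cases hb : b ∈ X
    · exact ⟨b, c, hb, hv, hbc⟩
    · exact ih hb

lemma exists_exit (h : PathOn K S u v) (hu : u ∈ S \ C) (hv : v ∈ C) :
    ∃ w y, w ∈ S \ C ∧ y ∈ C ∧ PathOn K (S \ C) u w ∧ (w, y) ∈ K := by
  induction h using Relation.ReflTransGen.head_induction_on with
  | refl => exact absurd hv hu.2
  | head hab hrest ih =>
    rename_i a b
    by_cases hb : b ∈ C
    · exact ⟨a, b, hu, hb, .refl, hab.2.2⟩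
    · obtain ⟨w, y, hw, hy, hp, he⟩ := ih ⟨hab.2.1, hb⟩
      exact ⟨w, y, hw, hy, .head ⟨hu, ⟨hab.2.1, hb⟩, hab.2.2⟩ hp, he⟩

lemma exists_entry (h : PathOn K S u v) (hu : u ∈ C) (hv : v ∈ S \ C) :
    ∃ c w, c ∈ C ∧ w ∈ S \ C ∧ (c, w) ∈ K ∧ PathOn K (S \ C) w v := by
  induction h with
  | refl => exact absurd hu hv.2
  | tail hrest hab ih =>
    rename_i a b
    by_cases ha : a ∈ C
    · exact ⟨a, b, ha, hv, hab.2.2, .refl⟩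
    · obtain ⟨c, w, hc, hw, he, hp⟩ := ih ⟨hab.1, ha⟩
      exact ⟨c, w, hc, hw, he, .tail hp ⟨⟨hab.1, ha⟩, hv, hab.2.2⟩⟩

end PathOn

section Augmentation

variable {V : Type*} {E K K' : Finset (V × V)} {S C : Set V} {c v w y : V}

lemma StronglyConnectedOn.mono (hK : K ⊆ K') (h : StronglyConnectedOn K S) :
    StronglyConnectedOn K' S :=
  fun u hu v hv => (h u hu v hv).mono hK subset_rfl

lemma TwinlessSConnOn.mono (hK : K ⊆ K') (h : TwinlessSConnOn K S) : TwinlessSConnOn K' S := by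
  obtain ⟨P, hP, h⟩ := h
  exact ⟨P, hP.trans hK, h⟩

/-- Strong connectivity only has to be checked through a single vertex. -/
lemma stronglyConnectedOn_of_center (h : ∀ x ∈ S, PathOn K S c x ∧ PathOn K S x c) :
    StronglyConnectedOn K S :=
  fun u hu v hv => (h u hu).2.trans (h v hv).1

/-- A twinless strongly connected vertex set absorbs the vertices of an ear, provided the ear
is not a pair of antiparallel edges. -/
lemma TwinlessSConnOn.exists_ear (h : TwinlessSConnOn K C) (hCS : C ⊆ S)
    (hc : c ∈ C) (hy : y ∈ C) (hv : v ∈ S \ C) (hw : w ∈ S \ C) (hcv : (c, v) ∈ K)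
    (hwy : (w, y) ∈ K) (hp : PathOn K (S \ C) v w) (hne : ¬ (v = w ∧ c = y)) :
    ∃ C', C ⊂ C' ∧ C' ⊆ S ∧ TwinlessSConnOn K C' := by
  classical
  obtain ⟨P, hP, hPa, hPc⟩ := h
  obtain ⟨Q, A, hQ, hA, hs⟩ := hp.exists_isSimplePath hw
  have hvA := hs.start_mem
  have hwA : w ∈ A := by
    rcases (hs.reach v hvA).2.cases_tail with rfl | ⟨b, -, hb⟩
    · exact hvA
    · exact (hs.edges_subset _ _ hb).2
  have hAC : ∀ x ∈ A, x ∉ C := fun x hx => (hA hx).2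
  let P' : Finset (V × V) := K.filter fun e =>
    (e ∈ P ∧ e.1 ∈ C ∧ e.2 ∈ C) ∨ e ∈ Q ∨ e = (c, v) ∨ e = (w, y)
  have memP : ∀ a b, (a, b) ∈ P' ↔ (a, b) ∈ K ∧
      (((a, b) ∈ P ∧ a ∈ C ∧ b ∈ C) ∨ (a, b) ∈ Q ∨ (a = c ∧ b = v) ∨ (a = w ∧ b = y)) := by
    intro a b
    simp [P']
  refine ⟨C ∪ A, ⟨Set.subset_union_left, fun hsub => hAC v hvA (hsub (Or.inr hvA))⟩,
    Set.union_subset hCS fun x hx => (hA hx).1, P', Finset.filter_subset _ _, ?_, ?_⟩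
  · intro a b hab hba
    rw [memP] at hab hba
    have hQs := hs.edges_subset
    have hQa := hs.no_antiparallel a b
    have h1 := hQs a b
    have h2 := hQs b a
    have h3 := hPa a b
    have h4 := hAC a
    have h5 := hAC b
    have h6 := hAC v hvA
    have h7 := hAC w hwA
    grind
  · have hPC : ∀ {p q}, p ∈ C → q ∈ C → PathOn P' (C ∪ A) p q := fun hp hq =>
      Relation.ReflTransGen.mono (fun a b hab => ⟨Or.inl hab.1, Or.inl hab.2.1,
        (memP a b).2 ⟨hP hab.2.2, Or.inl ⟨hab.2.2, hab.1, hab.2.1⟩⟩⟩) _ _ (hPc _ hp _ hq)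
    have hQA : ∀ {p q}, Relation.ReflTransGen (fun a b => (a, b) ∈ Q) p q →
        PathOn P' (C ∪ A) p q := fun hpq =>
      Relation.ReflTransGen.mono (fun a b hab => ⟨Or.inr (hs.edges_subset _ _ hab).1,
        Or.inr (hs.edges_subset _ _ hab).2, (memP a b).2 ⟨hQ hab, Or.inr (Or.inl hab)⟩⟩) _ _ hpq
    refine stronglyConnectedOn_of_center (c := c) ?_
    rintro x (hx | hx)
    · exact ⟨hPC hc hx, hPC hx hc⟩
    · refine ⟨.head ⟨Or.inl hc, Or.inr hvA, (memP _ _).2 ⟨hcv, by simp⟩⟩ (hQA (hs.reach x hx).1),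
        (Relation.ReflTransGen.tail (hQA (hs.reach x hx).2)
          ⟨Or.inr hwA, Or.inl hy, (memP _ _).2 ⟨hwy, by simp⟩⟩).trans (hPC hy hc)⟩

/-- A proper twinless strongly connected vertex set can be enlarged at the cost of at most one
additional edge. -/
lemma TwinlessSConnOn.exists_enlarge (h : TwinlessSConnOn K C) (hC : C.Nonempty) (hCS : C ⊂ S)
    (hK : StronglyConnectedOn K S) (hKE : K ⊆ E) (hE : TwinlessSConnOn E S) :
    ∃ K', K ⊆ K' ∧ K' ⊆ E ∧ K'.card ≤ K.card + 1 ∧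
      ∃ C', C ⊂ C' ∧ C' ⊆ S ∧ TwinlessSConnOn K' C' := by
  classical
  by_contra hcon
  have no_ear : ∀ {c v w y}, c ∈ C → v ∈ S \ C → (c, v) ∈ K → PathOn K (S \ C) v w →
      w ∈ S \ C → (w, y) ∈ K → y ∈ C → v = w ∧ c = y := by
    intro c v w y hc hv hcv hp hw hwy hy
    by_contra hne
    exact hcon ⟨K, subset_rfl, hKE, by simp,
      h.exists_ear hCS.1 hc hy hv hw hcv hwy hp hne⟩
  have no_ear_insert : ∀ {p q c v w y}, (p, q) ∈ E → c ∈ C → v ∈ S \ C →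
      (c, v) ∈ insert (p, q) K → PathOn (insert (p, q) K) (S \ C) v w →
      w ∈ S \ C → (w, y) ∈ insert (p, q) K → y ∈ C → v = w ∧ c = y := by
    intro p q c v w y hpq hc hv hcv hp hw hwy hy
    by_contra hne
    exact hcon ⟨insert (p, q) K, Finset.subset_insert _ _, Finset.insert_subset hpq hKE,
      Finset.card_insert_le _ _, (h.mono (Finset.subset_insert _ _)).exists_ear
        hCS.1 hc hy hv hw hcv hwy hp hne⟩
  obtain ⟨c₀, hc₀⟩ := hC
  obtain ⟨s, hsS, hsC⟩ := Set.exists_of_ssubset hCS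
  have leave : ∀ u ∈ S \ C, ∃ w y, w ∈ S \ C ∧ y ∈ C ∧ PathOn K (S \ C) u w ∧ (w, y) ∈ K :=
    fun u hu => (hK u hu.1 c₀ (hCS.1 hc₀)).exists_exit hu hc₀
  have enter : ∀ u ∈ S \ C, ∃ c w, c ∈ C ∧ w ∈ S \ C ∧ (c, w) ∈ K ∧ PathOn K (S \ C) w u :=
    fun u hu => (hK c₀ (hCS.1 hc₀) u hu.1).exists_entry hc₀ hu
  obtain ⟨c, v, hc, hv, hcv, -⟩ := enter s ⟨hsS, hsC⟩
  let W : Set V := {w | w ∈ S \ C ∧ PathOn K (S \ C) v w}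
  have hvW : v ∈ W := ⟨hv, .refl⟩
  have hcW : c ∉ W := fun hcW => hcW.1.2 hc
  have back : ∀ u ∈ W, PathOn K (S \ C) u v ∧ (v, c) ∈ K := by
    rintro u ⟨hu, hvu⟩
    obtain ⟨w, y, hw, hy, huw, hwy⟩ := leave u hu
    obtain ⟨rfl, rfl⟩ := no_ear hc hv hcv (hvu.trans huw) hw hwy hy
    exact ⟨huw, hwy⟩
  have hvc := (back v hvW).2
  have weaken : ∀ {e : V × V} {a b}, PathOn K (S \ C) a b → PathOn (insert e K) (S \ C) a b :=
    fun hab => hab.mono (Finset.subset_insert _ _) subset_rfl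
  have out : ∀ p q, (p, q) ∈ E → p ∈ W → q ∉ W → q ∈ S → p = v ∧ q = c := by
    intro p q hpq hp hq hqS
    by_cases hqC : q ∈ C
    · obtain ⟨rfl, rfl⟩ := no_ear_insert hpq hc hv (Finset.mem_insert_of_mem hcv)
        (weaken hp.2) hp.1 (Finset.mem_insert_self _ _) hqC
      exact ⟨rfl, rfl⟩
    · obtain ⟨w, y, hw, hy, hqw, hwy⟩ := leave q ⟨hqS, hqC⟩
      obtain ⟨rfl, rfl⟩ := no_ear_insert hpq hc hv (Finset.mem_insert_of_mem hcv)
        (((weaken hp.2).tail ⟨hp.1, ⟨hqS, hqC⟩, Finset.mem_insert_self _ _⟩).trans (weaken hqw)) hw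
        (Finset.mem_insert_of_mem hwy) hy
      obtain ⟨c', v', hc', hv', hcv', hvq'⟩ := enter q ⟨hqS, hqC⟩
      obtain ⟨rfl, rfl⟩ := no_ear hc' hv' hcv' (hvq'.trans hqw) hv hvc hc
      exact absurd ⟨⟨hqS, hqC⟩, hvq'⟩ hq
  have into : ∀ q p, (q, p) ∈ E → p ∈ W → q ∉ W → q ∈ S → q = c ∧ p = v := by
    intro q p hqp hp hq hqS
    by_cases hqC : q ∈ C
    · obtain ⟨rfl, rfl⟩ := no_ear_insert hqp hqC hp.1 (Finset.mem_insert_self _ _)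
        (weaken (back p hp).1) hv (Finset.mem_insert_of_mem hvc) hc
      exact ⟨rfl, rfl⟩
    · obtain ⟨c', v', hc', hv', hcv', hvq'⟩ := enter q ⟨hqS, hqC⟩
      obtain ⟨rfl, rfl⟩ := no_ear_insert hqp hc' hv' (Finset.mem_insert_of_mem hcv')
        (((weaken hvq').tail ⟨⟨hqS, hqC⟩, hp.1, Finset.mem_insert_self _ _⟩).trans
          (weaken (back p hp).1)) hv (Finset.mem_insert_of_mem hvc) hc
      exact absurd ⟨⟨hqS, hqC⟩, hvq'⟩ hq
  obtain ⟨E', hE', hEa, hEc⟩ := hE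
  obtain ⟨a, b, ha, hb, -, hbS, hab⟩ := (hEc v hv.1 c (hCS.1 hc)).exists_crossing hvW hcW
  obtain ⟨a', b', ha', hb', haS', -, hab'⟩ :=
    (hEc c (hCS.1 hc) v hv.1).exists_crossing (X := Wᶜ) hcW (fun h => h hvW)
  obtain ⟨rfl, rfl⟩ := out a b (hE' hab) ha hb hbS
  obtain ⟨rfl, rfl⟩ := into a' b' (hE' hab') (not_not.1 hb') ha' haS'
  exact hEa _ _ hab hab'

/-- A strongly connected subgraph of a twinless strongly connected graph can be made twinless
strongly connected by adding at most one edge for each vertex outside a given twinless strongly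
connected vertex set. -/
lemma TwinlessSConnOn.exists_augment [Finite V] (hE : TwinlessSConnOn E S) (hKE : K ⊆ E)
    (hK : StronglyConnectedOn K S) (hC : C.Nonempty) (hCS : C ⊆ S) (h : TwinlessSConnOn K C) :
    ∃ K', K ⊆ K' ∧ K' ⊆ E ∧ K'.card ≤ K.card + (S \ C).ncard ∧ TwinlessSConnOn K' S := by
  induction hm : (S \ C).ncard using Nat.strong_induction_on generalizing K C with
  | _ m ih =>
    rcases hCS.eq_or_ssubset with rfl | hss
    · exact ⟨K, subset_rfl, hKE, Nat.le_add_right _ _, h⟩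
    · obtain ⟨K₁, hK₁, hKE₁, hcard, C₁, hC₁, hCS₁, h₁⟩ := h.exists_enlarge hC hss hK hKE hE
      have hlt : (S \ C₁).ncard < m := by
        rw [← hm]
        obtain ⟨x, hx, hxC⟩ := Set.exists_of_ssubset hC₁
        exact Set.ncard_lt_ncard ⟨Set.sdiff_subset_sdiff_right hC₁.1,
          fun hsub => (hsub ⟨hCS₁ hx, hxC⟩).2 hx⟩
      obtain ⟨K₂, hK₂, hKE₂, hcard₂, h₂⟩ :=
        ih _ hlt hKE₁ (hK.mono hK₁) (hC.mono hC₁.1) hCS₁ h₁ rfl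
      exact ⟨K₂, hK₁.trans hK₂, hKE₂, by omega, h₂⟩

/-- A vertex with two distinct in- and out-neighbours can be added to a twinless strongly
connected vertex set. -/
lemma TwinlessSConnOn.univ_of_compl_singleton {x : V} (h : TwinlessSConnOn K ({x}ᶜ : Set V))
    (hc : c ≠ x) (hy : y ≠ x) (hcy : c ≠ y) (hcx : (c, x) ∈ K) (hxy : (x, y) ∈ K) :
    TwinlessSConnOn K Set.univ := by
  obtain ⟨C', hC', -, h'⟩ := h.exists_ear (S := Set.univ) (v := x) (w := x) (Set.subset_univ _)
    hc hy (by simp) (by simp) hcx hxy .refl (fun h => hcy h.2)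
  obtain ⟨z, hz, hzx⟩ := Set.exists_of_ssubset hC'
  obtain rfl : z = x := by simpa using hzx
  convert h'
  refine (Set.eq_univ_of_forall fun u => ?_).symm
  by_cases hu : u = z
  · exact hu ▸ hz
  · exact hC'.1 hu

/-- In a 2-vertex-connected graph every vertex has an in-neighbour and an out-neighbour that are
distinct from it and from each other. -/
lemma TwoVertexConnected.exists_neighbors [Fintype V] (h : TwoVertexConnected V K) (x : V) :
    ∃ c y, c ≠ x ∧ y ≠ x ∧ c ≠ y ∧ (c, x) ∈ K ∧ (x, y) ∈ K := by
  classical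
  obtain ⟨a, ha⟩ := Fintype.exists_ne_of_one_lt_card (by have := h.1; omega) x
  obtain ⟨c, x', hc, hx', -, -, hcx⟩ :=
    (h.2 ∅ (by simp) a (by simp) x (by simp)).exists_crossing (X := {x}ᶜ) ha (by simp)
  obtain rfl : x' = x := by simpa using hx'
  obtain ⟨b, hb⟩ : ∃ b, b ∉ ({x', c} : Finset V) := by
    by_contra! hall
    have h₁ : Fintype.card V ≤ ({x', c} : Finset V).card :=
      Finset.card_le_card fun z _ => hall z
    have h₂ := h.1
    have h₃ : ({x', c} : Finset V).card ≤ 2 := Finset.card_le_two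
    omega
  simp only [Finset.mem_insert, Finset.mem_singleton, not_or] at hb
  obtain ⟨x'', y, hx'', hy, -, hyS, hxy⟩ :=
    (h.2 {c} (by simp) x' (by simpa using Ne.symm hc) b (by simpa using hb.2)).exists_crossing
      (X := {x'}) rfl hb.1
  obtain rfl : x'' = x' := hx''
  exact ⟨c, y, hc, hy, fun hcy => by simp [hcy] at hyS, hcx, hxy⟩

end Augmentation

/-- a 2-vertex-connected spanning subgraph of a 2-vertex-twinless connected
graph can be augmented to a 2-vertex-twinless connected spanning subgraph by adding at most
`a_t · (n − 1)` edges, where `a_t` is its number of twinless articulation points. -/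
theorem stmt8 {V : Type*} [Fintype V] (E E2v : Finset (V × V)) (n at_ : ℕ)
    (hn : n = Fintype.card V)
    (hG : TwoVertexTwinlessConnected V E)
    (hsub : E2v ⊆ E) (h2vc : TwoVertexConnected V E2v)
    (hat : at_ = Set.ncard {x : V | ¬ TwinlessSConnOn E2v ({x}ᶜ : Set V)}) :
    ∃ E2t : Finset (V × V), E2v ⊆ E2t ∧ E2t ⊆ E ∧
      TwoVertexTwinlessConnected V E2t ∧
      E2t.card ≤ E2v.card + at_ * (n - 1) := by
  classical
  have hE : ∀ x : V, TwinlessSConnOn E ({x}ᶜ : Set V) := fun x => by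
    simpa using hG.2 {x} (by simp)
  have hS : ∀ x : V, StronglyConnectedOn E2v ({x}ᶜ : Set V) := fun x => by
    simpa using h2vc.2 {x} (by simp)
  have key : ∀ x : V, ∃ K, E2v ⊆ K ∧ K ⊆ E ∧ K.card ≤ E2v.card + (n - 1) ∧
      TwinlessSConnOn K ({x}ᶜ : Set V) := by
    intro x
    obtain ⟨s, hs⟩ := Fintype.exists_ne_of_one_lt_card (by have := hG.1; omega) x
    have hone : TwinlessSConnOn E2v ({s} : Set V) := by
      refine ⟨∅, by simp, by simp [NoAntiparallel], ?_⟩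
      rintro u rfl v rfl
      exact .refl
    obtain ⟨K, h₁, h₂, h₃, h₄⟩ := (hE x).exists_augment hsub (hS x) (Set.singleton_nonempty s)
      (Set.singleton_subset_iff.2 hs) hone
    refine ⟨K, h₁, h₂, h₃.trans (Nat.add_le_add_left ?_ _), h₄⟩
    have hle : (({x}ᶜ : Set V) \ {s}).ncard ≤ ({x}ᶜ : Set V).ncard :=
      Set.ncard_le_ncard Set.sdiff_subset
    rwa [Set.ncard_compl, Set.ncard_singleton, Nat.card_eq_fintype_card, ← hn] at hle
  choose K hK hKE hKcard hKt using key
  let X : Finset V := Finset.univ.filter fun x => ¬ TwinlessSConnOn E2v ({x}ᶜ : Set V)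
  have hX : at_ = X.card := by
    rw [hat, ← Set.ncard_coe_finset]
    simp [X]
  let F : Finset (V × V) := E2v ∪ X.biUnion fun x => K x \ E2v
  have hsubF : E2v ⊆ F := Finset.subset_union_left
  have hF : ∀ x : V, TwinlessSConnOn F ({x}ᶜ : Set V) := by
    intro x
    by_cases hx : TwinlessSConnOn E2v ({x}ᶜ : Set V)
    · exact hx.mono hsubF
    · refine (hKt x).mono fun e he => ?_
      by_cases heE : e ∈ E2v
      · exact hsubF heE
      · exact Finset.mem_union_right _ (Finset.mem_biUnion.2
          ⟨x, by simpa [X] using hx, Finset.mem_sdiff.2 ⟨he, heE⟩⟩)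
  refine ⟨F, hsubF, ?_, ⟨hG.1, ?_⟩, ?_⟩
  · refine Finset.union_subset hsub (Finset.biUnion_subset.2 fun x _ => ?_)
    exact Finset.sdiff_subset.trans (hKE x)
  · intro U hU
    have : Nonempty V := Fintype.card_pos_iff.1 (by have := hG.1; omega)
    obtain ⟨x, hx⟩ := Finset.card_le_one_iff_subset_singleton.1 hU
    rcases Finset.subset_singleton_iff.1 hx with rfl | rfl
    · obtain ⟨c, y, hc, hy, hcy, hcx, hxy⟩ := h2vc.exists_neighbors x
      simpa using (hF x).univ_of_compl_singleton hc hy hcy (hsubF hcx) (hsubF hxy)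
    · simpa using hF x
  · refine (Finset.card_union_le _ _).trans (Nat.add_le_add_left ?_ _)
    rw [hX]
    refine Finset.card_biUnion_le_card_mul _ _ _ fun x _ => ?_
    rw [Finset.card_sdiff_of_subset (hK x)]
    have := hKcard x
    omega
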